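/- Let q ∈ ℂ× be a number that is not a root of unity, and let 𝐀 be the q-Weyl algebra. Then the Hochschild cohomology of 𝐀 satisfies: HH^0(𝐀) ≅ ℂ, HH^1(𝐀) ≅ ℂ², HH^2(𝐀) ≅ ℂ, and HH^i(𝐀) = 0 for all i ≠ 0, 1, 2. -/

import Mathlib

open TensorProduct CategoryTheory MulOpposite

noncomputable section

/-- The enveloping algebra `S ⊗[ℂ] Sᵐᵒᵖ` of a `ℂ`-algebra `S`. -/
abbrev env (S : Type) [Ring S] [Algebra ℂ S] : Type := S ⊗[ℂ] Sᵐᵒᵖ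

/-- `S` as a left module over its enveloping algebra (via `(x ⊗ yᵒᵖ) • s = x * s * y`). -/
abbrev envBimod (S : Type) [Ring S] [Algebra ℂ S] : ModuleCat (env S) :=
  @ModuleCat.of (env S) _ S _ (TensorProduct.Algebra.module)

/-- Hochschild cohomology with coefficients: `HH^i(S, N) = Ext^i_{S^e}(S, N)`. -/
abbrev HHext (S : Type) [Ring S] [Algebra ℂ S] (i : ℕ) (N : ModuleCat (env S)) : ModuleCat ℂ :=
  ((Ext ℂ (ModuleCat (env S)) i).obj (Opposite.op (envBimod S))).obj N

/-- Hochschild cohomology `HH^i(S) = Ext^i_{S^e}(S, S)`. -/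
abbrev HHcoh (S : Type) [Ring S] [Algebra ℂ S] (i : ℕ) : ModuleCat ℂ :=
  HHext S i (envBimod S)

/-- The defining relations of the `q`-Weyl algebra
(generators: `0 ↦ X`, `1 ↦ X⁻¹`, `2 ↦ P`, `3 ↦ P⁻¹`):
`X X⁻¹ = 1`, `X⁻¹ X = 1`, `P P⁻¹ = 1`, `P⁻¹ P = 1`, `X P = q P X`. -/
inductive qWeylRel (q : ℂ) : FreeAlgebra ℂ (Fin 4) → FreeAlgebra ℂ (Fin 4) → Prop
  | relXXinv : qWeylRel q (FreeAlgebra.ι ℂ 0 * FreeAlgebra.ι ℂ 1) 1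
  | relXinvX : qWeylRel q (FreeAlgebra.ι ℂ 1 * FreeAlgebra.ι ℂ 0) 1
  | relPPinv : qWeylRel q (FreeAlgebra.ι ℂ 2 * FreeAlgebra.ι ℂ 3) 1
  | relPinvP : qWeylRel q (FreeAlgebra.ι ℂ 3 * FreeAlgebra.ι ℂ 2) 1
  | relXP : qWeylRel q (FreeAlgebra.ι ℂ 0 * FreeAlgebra.ι ℂ 2)
      (algebraMap ℂ (FreeAlgebra ℂ (Fin 4)) q * (FreeAlgebra.ι ℂ 2 * FreeAlgebra.ι ℂ 0))

/-- The `q`-Weyl algebra `𝐀`. -/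
abbrev QWeyl (q : ℂ) : Type := RingQuot (qWeylRel q)

/-- The generator `X` of the `q`-Weyl algebra. -/
def QWeyl.X (q : ℂ) : QWeyl q := RingQuot.mkAlgHom ℂ (qWeylRel q) (FreeAlgebra.ι ℂ 0)

/-- The generator `X⁻¹` of the `q`-Weyl algebra. -/
def QWeyl.Xinv (q : ℂ) : QWeyl q := RingQuot.mkAlgHom ℂ (qWeylRel q) (FreeAlgebra.ι ℂ 1)

/-- The generator `P` of the `q`-Weyl algebra. -/
def QWeyl.P (q : ℂ) : QWeyl q := RingQuot.mkAlgHom ℂ (qWeylRel q) (FreeAlgebra.ι ℂ 2)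

/-- The generator `P⁻¹` of the `q`-Weyl algebra. -/
def QWeyl.Pinv (q : ℂ) : QWeyl q := RingQuot.mkAlgHom ℂ (qWeylRel q) (FreeAlgebra.ι ℂ 3)

/-! ### The Koszul resolution attached to two commuting elements -/

namespace Koszul

variable {R : Type} [Ring R] (u v : R)

/-- The terms of the Koszul complex of two elements. -/
def obj (R : Type) [Ring R] : ℕ → ModuleCat.{0} R
  | 0 => ModuleCat.of R R
  | 1 => ModuleCat.of R (R × R)
  | 2 => ModuleCat.of R R
  | _ + 3 => ModuleCat.of R PUnit

/-- The differential `(s, t) ↦ s * u + t * v`. -/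
def dOne : R × R →ₗ[R] R :=
  (LinearMap.toSpanSingleton R R u).coprod (LinearMap.toSpanSingleton R R v)

/-- The differential `w ↦ (-(w * v), w * u)`. -/
def dTwo : R →ₗ[R] R × R :=
  (-LinearMap.toSpanSingleton R R v).prod (LinearMap.toSpanSingleton R R u)

@[simp] lemma dOne_apply (x : R × R) : dOne u v x = x.1 * u + x.2 * v := by simp [dOne]

@[simp] lemma dTwo_apply (w : R) : dTwo u v w = (-(w * v), w * u) := by simp [dTwo]

/-- The differentials of the Koszul complex of two elements. -/
def d : ∀ n, obj R (n + 1) ⟶ obj R n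
  | 0 => ModuleCat.ofHom (dOne u v)
  | 1 => ModuleCat.ofHom (dTwo u v)
  | _ + 2 => 0

variable {u v}

/-- The Koszul complex of two commuting elements, acting on the right. -/
def complex (huv : Commute u v) : ChainComplex (ModuleCat.{0} R) ℕ :=
  ChainComplex.of (obj R) (d u v) <| by
    rintro (_ | n)
    · refine ModuleCat.hom_ext (LinearMap.ext fun (x : R) => ?_)
      change dOne u v (dTwo u v x) = 0
      simp [mul_assoc, huv.eq]
    · exact Limits.zero_comp

variable (huv : Commute u v)

lemma complex_d (n : ℕ) : (complex huv).d (n + 1) n = d u v n := ChainComplex.of_d ..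

instance projective_obj (n : ℕ) : Projective (obj R n) := by
  rcases n with _ | _ | _ | n <;> dsimp only [obj] <;>
    exact ModuleCat.projective_of_free (Module.Free.chooseBasis R _)

variable {M : ModuleCat.{0} R} {m : M} (hu : u • m = 0) (hv : v • m = 0)

/-- The augmentation `r ↦ r • m` of the Koszul complex. -/
def augmentation : complex huv ⟶ (ChainComplex.single₀ (ModuleCat.{0} R)).obj M :=
  ((complex huv).toSingle₀Equiv M).symm
    ⟨ModuleCat.ofHom (LinearMap.toSpanSingleton R M m), by
      rw [complex_d]
      refine ModuleCat.hom_ext (LinearMap.ext fun (x : R × R) => ?_)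
      change (dOne u v x) • m = 0
      rw [dOne_apply, add_smul, mul_smul, mul_smul, hu, hv, smul_zero, smul_zero, add_zero]⟩

lemma augmentation_f_zero_apply (r : R) :
    ((augmentation huv hu hv).f 0).hom r = r • m := by
  simp [augmentation, ChainComplex.toSingle₀Equiv]
  rfl

/-- The Koszul complex as a projective resolution, when it is exact. -/
def resolution (h₀ : ∀ y : M, ∃ r : R, r • m = y)
    (h₁ : ∀ r : R, r • m = 0 → ∃ s t : R, s * u + t * v = r)
    (h₂ : ∀ s t : R, s * u + t * v = 0 → ∃ w : R, -(w * v) = s ∧ w * u = t)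
    (h₃ : ∀ w : R, w * u = 0 → w = 0) : ProjectiveResolution M where
  complex := complex huv
  projective n := projective_obj n
  π := augmentation huv hu hv
  quasiIso := ⟨fun n => by
    rcases n with _ | n
    · rw [ChainComplex.quasiIsoAt₀_iff, ShortComplex.quasiIso_iff_of_zeros' _ rfl rfl rfl]
      constructor
      · rw [ShortComplex.moduleCat_exact_iff]
        intro r hr
        obtain ⟨s, t, rfl⟩ := h₁ r ((augmentation_f_zero_apply huv hu hv r).symm.trans hr)
        refine ⟨(s, t), ?_⟩
        change ((complex huv).d 1 0).hom _ = _
        rw [complex_d]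
        exact dOne_apply u v _
      · rw [ModuleCat.epi_iff_surjective]
        intro y
        obtain ⟨r, hr⟩ := h₀ y
        exact ⟨r, (augmentation_f_zero_apply huv hu hv r).trans hr⟩
    · rw [quasiIsoAt_iff_exactAt' (hL := ChainComplex.exactAt_succ_single_obj ..),
        HomologicalComplex.exactAt_iff' _ (n + 2) (n + 1) n (by simp) (by simp),
        ShortComplex.moduleCat_exact_iff]
      dsimp only [HomologicalComplex.sc', HomologicalComplex.shortComplexFunctor']
      rw [complex_d, complex_d]
      rcases n with _ | _ | n
      · rintro ⟨s, t⟩ hx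
        obtain ⟨w, rfl, rfl⟩ := h₂ s t ((dOne_apply u v _).symm.trans hx)
        exact ⟨w, dTwo_apply u v w⟩
      · intro w hw
        exact ⟨0, ((map_zero _).trans (h₃ w (congrArg Prod.snd
          ((dTwo_apply u v w).symm.trans hw))).symm)⟩
      · intro x _
        exact ⟨0, rfl⟩⟩

end Koszul

/-- The homology of a short complex of modules is identified by a linear map which is onto on
cycles and whose kernel on cycles is the boundaries. -/
lemma nonempty_homology_iso {k : Type} [Ring k] (S : ShortComplex (ModuleCat.{0} k)) {W : Type}
    [AddCommGroup W] [Module k W] (φ : S.X₂ →ₗ[k] W)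
    (hsurj : ∀ w, ∃ x, S.g x = 0 ∧ φ x = w)
    (hker : ∀ x, S.g x = 0 → (φ x = 0 ↔ ∃ y, S.f y = x)) :
    Nonempty (S.homology ≅ ModuleCat.of k W) := by
  let ψ : LinearMap.ker S.g.hom →ₗ[k] W := φ ∘ₗ Submodule.subtype _
  have hψ : LinearMap.range ψ = ⊤ := LinearMap.range_eq_top.2 fun w => by
    obtain ⟨x, hx, rfl⟩ := hsurj w
    exact ⟨⟨x, hx⟩, rfl⟩
  have hψ' : LinearMap.range S.moduleCatToCycles = LinearMap.ker ψ := by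
    ext ⟨x, hx⟩
    refine Iff.trans ?_ (hker x hx).symm
    exact exists_congr fun y => Subtype.ext_iff
  exact ⟨S.moduleCatHomologyIso ≪≫ LinearEquiv.toModuleIso
    ((Submodule.quotEquivOfEq _ _ hψ').trans (ψ.quotKerEquivOfSurjective
      (LinearMap.range_eq_top.1 hψ)))⟩

namespace Koszul

variable {k : Type} [Field k] {R : Type} [Ring R] [Algebra k R] {u v : R} (huv : Commute u v)
  (N : ModuleCat.{0} R) {W : Type} [AddCommGroup W] [Module k W]

@[simp]
lemma linearYonedaObj_d_apply (n : ℕ) (f : obj R n ⟶ N) :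
    (((complex huv).linearYonedaObj k N).d n (n + 1)).hom f = d u v n ≫ f := by
  rw [← complex_d huv]
  rfl

lemma nonempty_homology_zero_iso (φ : N →+ W)
    (hφ : ∀ (c : k) (x : N), φ (algebraMap k R c • x) = c • φ x)
    (hsurj : ∀ w, ∃ x : N, u • x = 0 ∧ v • x = 0 ∧ φ x = w)
    (hinj : ∀ x : N, u • x = 0 → v • x = 0 → φ x = 0 → x = 0) :
    Nonempty (((complex huv).linearYonedaObj k N).homology 0 ≅ ModuleCat.of k W) := by
  refine Nonempty.map ((((complex huv).linearYonedaObj k N).homologyIsoSc' 0 0 1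
    (by simp) (by simp)) ≪≫ ·) ?_
  have hd (f : obj R 0 ⟶ N) : (d u v 0 ≫ f : obj R 1 ⟶ N) = 0 ↔
      u • f.hom (1 : R) = 0 ∧ v • f.hom (1 : R) = 0 := by
    let f' : R →ₗ[R] N := ModuleCat.Hom.hom f
    change _ ↔ u • f' 1 = 0 ∧ v • f' 1 = 0
    have hf (x : R × R) : (d u v 0 ≫ f : obj R 1 ⟶ N).hom x = x.1 • u • f' 1 + x.2 • v • f' 1 := by
      change f' (dOne u v x) = _
      rw [← map_smul, ← map_smul, ← map_smul, ← map_smul, ← map_add, dOne_apply]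
      simp
    refine ⟨fun h => ⟨?_, ?_⟩, fun h => ModuleCat.hom_ext (LinearMap.ext fun (x : R × R) => ?_)⟩
    · simpa using (hf (1, 0)).symm.trans (by rw [h]; rfl)
    · simpa using (hf (0, 1)).symm.trans (by rw [h]; rfl)
    · refine (hf x).trans ?_
      rw [h.1, h.2, smul_zero, smul_zero, add_zero]
      rfl
  refine nonempty_homology_iso _ (W := W)
    ⟨⟨fun f => φ (f.hom (1 : R)), fun f g => ?_⟩, fun c f => ?_⟩ ?_ ?_
  · exact φ.map_add _ _
  · exact hφ c _
  · intro w
    obtain ⟨x, hu, hv, rfl⟩ := hsurj w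
    refine ⟨ModuleCat.ofHom (LinearMap.toSpanSingleton R N x), ?_, ?_⟩
    · refine (linearYonedaObj_d_apply huv N 0 _).trans ((hd _).2 ?_)
      change u • (1 : R) • x = 0 ∧ v • (1 : R) • x = 0
      rw [one_smul]
      exact ⟨hu, hv⟩
    · change φ ((1 : R) • x) = _
      rw [one_smul]
  · intro f hf
    have hf' := (hd f).1 ((linearYonedaObj_d_apply huv N 0 f).symm.trans hf)
    have hz : ((complex huv).linearYonedaObj k N).d 0 0 = 0 :=
      HomologicalComplex.shape _ _ _ (by simp)
    refine ⟨fun h => ⟨0, ?_⟩, ?_⟩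
    · refine (map_zero _).trans (Eq.symm ?_)
      exact ModuleCat.hom_ext (LinearMap.ext_ring (hinj _ hf'.1 hf'.2 h))
    · rintro ⟨g, rfl⟩
      have : (((complex huv).linearYonedaObj k N).d 0 0).hom g = 0 := by rw [hz]; rfl
      exact (congrArg (fun f : obj R 0 ⟶ N => φ (f.hom (1 : R))) this).trans (map_zero φ)

lemma nonempty_homology_one_iso (φ : N × N →+ W)
    (hφ : ∀ (c : k) (x : N × N), φ (algebraMap k R c • x) = c • φ x)
    (hsurj : ∀ w, ∃ x : N × N, v • x.1 = u • x.2 ∧ φ x = w)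
    (hker : ∀ x : N × N, v • x.1 = u • x.2 → (φ x = 0 ↔ ∃ y : N, (u • y, v • y) = x)) :
    Nonempty (((complex huv).linearYonedaObj k N).homology 1 ≅ ModuleCat.of k W) := by
  refine Nonempty.map ((((complex huv).linearYonedaObj k N).homologyIsoSc' 0 1 2
    (by simp) (by simp)) ≪≫ ·) ?_
  let ev (f : obj R 1 ⟶ N) : N × N := (f.hom ((1, 0) : R × R), f.hom ((0, 1) : R × R))
  have hev (f g : obj R 1 ⟶ N) (h : ev f = ev g) : f = g :=
    ModuleCat.hom_ext (LinearMap.prod_ext (LinearMap.ext_ring (congrArg Prod.fst h))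
      (LinearMap.ext_ring (congrArg Prod.snd h)))
  have hd (f : obj R 1 ⟶ N) : (d u v 1 ≫ f : obj R 2 ⟶ N) = 0 ↔ v • (ev f).1 = u • (ev f).2 := by
    let f' : R × R →ₗ[R] N := ModuleCat.Hom.hom f
    change _ ↔ v • f' (1, 0) = u • f' (0, 1)
    have hf : (d u v 1 ≫ f : obj R 2 ⟶ N).hom (1 : R) = u • f' (0, 1) - v • f' (1, 0) := by
      change f' (dTwo u v 1) = _
      rw [← map_smul, ← map_smul, ← map_sub, dTwo_apply]
      simp
    rw [eq_comm (a := v • _), ← sub_eq_zero (a := u • _), ← hf]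
    exact ⟨fun h => by rw [h]; rfl, fun h => ModuleCat.hom_ext (LinearMap.ext_ring h)⟩
  have hd' (f : obj R 0 ⟶ N) : ev (d u v 0 ≫ f) = (u • f.hom (1 : R), v • f.hom (1 : R)) := by
    let f' : R →ₗ[R] N := ModuleCat.Hom.hom f
    change (f' (dOne u v (1, 0)), f' (dOne u v (0, 1))) = (u • f' 1, v • f' 1)
    rw [← map_smul, ← map_smul]
    simp
  refine nonempty_homology_iso _ (W := W)
    ⟨⟨fun f => φ (ev f), fun f g => ?_⟩, fun c f => ?_⟩ ?_ ?_
  · exact φ.map_add (ev f) (ev g)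
  · exact hφ c (ev f)
  · intro w
    obtain ⟨x, hx, rfl⟩ := hsurj w
    let f : obj R 1 ⟶ N := ModuleCat.ofHom ((LinearMap.toSpanSingleton R N x.1).coprod
        (LinearMap.toSpanSingleton R N x.2))
    have hf : ev f = x := by
      change (LinearMap.coprod _ _ ((1, 0) : R × R), LinearMap.coprod _ _ ((0, 1) : R × R)) = x
      simp
    refine ⟨f, (linearYonedaObj_d_apply huv N 1 _).trans ((hd _).2 ?_), congrArg φ hf⟩
    rw [hf, hx]
  · intro f hf
    refine (hker (ev f) ((hd f).1 ((linearYonedaObj_d_apply huv N 1 f).symm.trans hf))).trans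
      ⟨?_, ?_⟩
    · rintro ⟨y, hy⟩
      refine ⟨ModuleCat.ofHom (LinearMap.toSpanSingleton R N y), ?_⟩
      refine (linearYonedaObj_d_apply huv N 0 _).trans (hev _ _ ?_)
      refine (hd' _).trans (Eq.trans ?_ hy)
      change (u • (1 : R) • y, v • (1 : R) • y) = _
      rw [one_smul]
    · rintro ⟨g, rfl⟩
      exact ⟨_, (hd' g).symm.trans (congrArg ev (linearYonedaObj_d_apply huv N 0 g)).symm⟩

lemma nonempty_homology_two_iso (φ : N →+ W)
    (hφ : ∀ (c : k) (x : N), φ (algebraMap k R c • x) = c • φ x)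
    (hsurj : ∀ w, ∃ x : N, φ x = w)
    (hker : ∀ x : N, φ x = 0 ↔ ∃ y : N × N, u • y.2 - v • y.1 = x) :
    Nonempty (((complex huv).linearYonedaObj k N).homology 2 ≅ ModuleCat.of k W) := by
  refine Nonempty.map ((((complex huv).linearYonedaObj k N).homologyIsoSc' 1 2 3
    (by simp) (by simp)) ≪≫ ·) ?_
  refine nonempty_homology_iso _ (W := W)
    ⟨⟨fun f => φ (f.hom (1 : R)), fun f g => ?_⟩, fun c f => ?_⟩ ?_ ?_
  · exact φ.map_add _ _
  · exact hφ c _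
  · intro w
    obtain ⟨x, rfl⟩ := hsurj w
    refine ⟨ModuleCat.ofHom (LinearMap.toSpanSingleton R N x), ?_, ?_⟩
    · refine (linearYonedaObj_d_apply huv N 2 _).trans ?_
      exact Limits.zero_comp
    · change φ ((1 : R) • x) = _
      rw [one_smul]
  · intro f _
    refine (hker _).trans ⟨?_, ?_⟩
    · rintro ⟨y, hy⟩
      refine ⟨ModuleCat.ofHom ((LinearMap.toSpanSingleton R N y.1).coprod
        (LinearMap.toSpanSingleton R N y.2)), ?_⟩
      refine (linearYonedaObj_d_apply huv N 1 _).trans ?_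
      refine ModuleCat.hom_ext (LinearMap.ext_ring ?_)
      refine Eq.trans ?_ hy
      change LinearMap.coprod _ _ (dTwo u v 1) = _
      simp
      abel
    · rintro ⟨g, rfl⟩
      let g' : R × R →ₗ[R] N := ModuleCat.Hom.hom g
      refine ⟨(g' (1, 0), g' (0, 1)), ?_⟩
      refine Eq.trans ?_ (congrArg (fun f : obj R 2 ⟶ N => f.hom (1 : R))
        (linearYonedaObj_d_apply huv N 1 g)).symm
      change _ = g' (dTwo u v 1)
      rw [← map_smul, ← map_smul, ← map_sub, dTwo_apply]
      simp

lemma isZero_homology (n : ℕ) :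
    Limits.IsZero (((complex huv).linearYonedaObj k N).homology (n + 3)) := by
  rw [← HomologicalComplex.exactAt_iff_isZero_homology, HomologicalComplex.exactAt_iff]
  refine ShortComplex.exact_of_isZero_X₂ _ ?_
  rw [Limits.IsZero.iff_id_eq_zero]
  refine ModuleCat.hom_ext (LinearMap.ext fun (f : obj R (n + 3) ⟶ N) => ?_)
  exact ModuleCat.hom_ext (LinearMap.ext fun x => map_zero f.hom)

end Koszul

/-- Nonzero scalars as units of an algebra. -/
def scalarUnit {S : Type} [Semiring S] [Algebra ℂ S] : ℂˣ →* Sˣ :=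
  Units.map (algebraMap ℂ S).toMonoidHom

lemma scalarUnit_commute {S : Type} [Semiring S] [Algebra ℂ S] (c : ℂˣ) (a : Sˣ) :
    Commute (scalarUnit c) a :=
  Units.ext (Algebra.commutes (c : ℂ) (a : S))

lemma val_scalarUnit_mul {S : Type} [Semiring S] [Algebra ℂ S] (c : ℂˣ) (a : Sˣ) :
    ((scalarUnit c * a : Sˣ) : S) = (c : ℂ) • (a : S) :=
  (Algebra.smul_def _ _).symm

namespace QWeyl

variable (q : ℂ)

lemma X_mul_Xinv : X q * Xinv q = 1 := by
  rw [X, Xinv, ← map_mul, RingQuot.mkAlgHom_rel ℂ qWeylRel.relXXinv, map_one]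

lemma Xinv_mul_X : Xinv q * X q = 1 := by
  rw [X, Xinv, ← map_mul, RingQuot.mkAlgHom_rel ℂ qWeylRel.relXinvX, map_one]

lemma P_mul_Pinv : P q * Pinv q = 1 := by
  rw [P, Pinv, ← map_mul, RingQuot.mkAlgHom_rel ℂ qWeylRel.relPPinv, map_one]

lemma Pinv_mul_P : Pinv q * P q = 1 := by
  rw [P, Pinv, ← map_mul, RingQuot.mkAlgHom_rel ℂ qWeylRel.relPinvP, map_one]

lemma X_mul_P : X q * P q = algebraMap ℂ (QWeyl q) q * (P q * X q) := by
  rw [X, P, ← map_mul, RingQuot.mkAlgHom_rel ℂ qWeylRel.relXP, map_mul, map_mul,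
    AlgHom.commutes]

/-- The unit `X` of the `q`-Weyl algebra. -/
def unitX : (QWeyl q)ˣ := ⟨X q, Xinv q, X_mul_Xinv q, Xinv_mul_X q⟩

/-- The unit `P` of the `q`-Weyl algebra. -/
def unitP : (QWeyl q)ˣ := ⟨P q, Pinv q, P_mul_Pinv q, Pinv_mul_P q⟩

variable {q}

variable (u : ℂˣ)

lemma unitX_mul_unitP :
    unitX (u : ℂ) * unitP u = scalarUnit u * (unitP u * unitX u) :=
  Units.ext (X_mul_P (u : ℂ))

lemma unitX_conj_unitP_zpow (j : ℤ) :
    unitX (u : ℂ) * unitP u ^ j = scalarUnit (u ^ j) * (unitP u ^ j * unitX u) := by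
  have h : unitX (u : ℂ) * unitP u * (unitX (u : ℂ))⁻¹ = scalarUnit u * unitP u := by
    rw [unitX_mul_unitP]; group
  have := congrArg (· ^ j) h
  simp only [conj_zpow, (scalarUnit_commute u (unitP (u : ℂ))).mul_zpow] at this
  rw [map_zpow, ← mul_assoc, ← this]; group

lemma unitX_zpow_mul_unitP_zpow (i j : ℤ) :
    unitX (u : ℂ) ^ i * unitP u ^ j =
      scalarUnit (u ^ (i * j)) * (unitP u ^ j * unitX u ^ i) := by
  have h : (unitP (u : ℂ) ^ j)⁻¹ * unitX (u : ℂ) * ((unitP (u : ℂ) ^ j)⁻¹)⁻¹ =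
      scalarUnit (u ^ j) * unitX u := by
    rw [mul_assoc, inv_inv, unitX_conj_unitP_zpow, ← mul_assoc,
      ← (scalarUnit_commute _ _).eq]; group
  have := congrArg (· ^ i) h
  simp only [conj_zpow, (scalarUnit_commute (u ^ j) (unitX (u : ℂ))).mul_zpow] at this
  rw [mul_comm i j, zpow_mul, map_zpow, ← mul_assoc, (scalarUnit_commute _ _).zpow_left i |>.eq,
    mul_assoc, ← this]
  group

/-- The unit `X ^ i * P ^ j`, where `n = (i, j)`. -/
def monomial (q : ℂ) (n : ℤ × ℤ) : (QWeyl q)ˣ := unitX q ^ n.1 * unitP q ^ n.2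

lemma unitX_mul_monomial (q : ℂ) (n : ℤ × ℤ) :
    unitX q * monomial q n = monomial q (n.1 + 1, n.2) := by
  simp [monomial, zpow_add, ← mul_assoc, (Commute.refl (unitX q)).zpow_right n.1 |>.eq]

lemma monomial_mul_unitP (q : ℂ) (n : ℤ × ℤ) :
    monomial q n * unitP q = monomial q (n.1, n.2 + 1) := by
  simp [monomial, zpow_add, mul_assoc]

lemma unitP_mul_monomial (n : ℤ × ℤ) :
    unitP (u : ℂ) * monomial u n = scalarUnit (u ^ (-n.1)) * monomial u (n.1, n.2 + 1) := by
  have := unitX_zpow_mul_unitP_zpow u n.1 1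
  rw [mul_one, zpow_one] at this
  rw [monomial, monomial, add_comm n.2 1, zpow_add, zpow_one, ← mul_assoc (unitX _ ^ _), this]
  simp only [← mul_assoc, ← map_mul]
  simp

lemma monomial_mul_unitX (n : ℤ × ℤ) :
    monomial u n * unitX (u : ℂ) = scalarUnit (u ^ (-n.2)) * monomial u (n.1 + 1, n.2) := by
  have := unitX_zpow_mul_unitP_zpow u 1 n.2
  rw [one_mul, zpow_one] at this
  rw [monomial, monomial, zpow_add, zpow_one, mul_assoc (unitX _ ^ _), mul_assoc (unitX _ ^ _),
    this, ← mul_assoc _ (scalarUnit _), ← (scalarUnit_commute _ _).eq, ← mul_assoc,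
    ← mul_assoc (scalarUnit _), ← mul_assoc (scalarUnit _), ← map_mul]
  simp [mul_assoc]

lemma monomial_inv (n : ℤ × ℤ) :
    (monomial (u : ℂ) n)⁻¹ = scalarUnit (u ^ (-(n.1 * n.2))) * monomial u (-n) := by
  have := unitX_zpow_mul_unitP_zpow u (-n.1) (-n.2)
  simp only [monomial, Prod.fst_neg, Prod.snd_neg, this]
  rw [← mul_assoc, ← map_mul]
  simp

/-! ### The regular representation on `ℂ[ℤ × ℤ]` -/

/-- The action of the four generators on `ℂ[ℤ × ℤ]`. -/
def repGen : Fin 4 → Module.End ℂ (ℤ × ℤ →₀ ℂ) := ![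
  Finsupp.linearCombination ℂ fun n => Finsupp.single (n.1 + 1, n.2) 1,
  Finsupp.linearCombination ℂ fun n => Finsupp.single (n.1 - 1, n.2) 1,
  Finsupp.linearCombination ℂ fun n => Finsupp.single (n.1, n.2 + 1) ((u : ℂ) ^ (-n.1)),
  Finsupp.linearCombination ℂ fun n => Finsupp.single (n.1, n.2 - 1) ((u : ℂ) ^ n.1)]

/-- The representation of the `q`-Weyl algebra on `ℂ[ℤ × ℤ]`. -/
def rep : QWeyl (u : ℂ) →ₐ[ℂ] Module.End ℂ (ℤ × ℤ →₀ ℂ) :=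
  RingQuot.liftAlgHom ℂ ⟨FreeAlgebra.lift ℂ (repGen u), by
    rintro _ _ (_ | _) <;> refine Finsupp.lhom_ext' fun n => LinearMap.ext_ring ?_ <;>
      simp [repGen, zpow_add₀, ← mul_assoc, -Finsupp.single_mul,
        mul_inv_cancel₀ (zpow_ne_zero _ u.ne_zero),
        inv_mul_cancel₀ (zpow_ne_zero _ u.ne_zero)]⟩

lemma rep_mkAlgHom_ι (i : Fin 4) :
    rep u (RingQuot.mkAlgHom ℂ (qWeylRel u) (FreeAlgebra.ι ℂ i)) = repGen u i := by
  simp [rep]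

/-- The linear map `ℂ[ℤ × ℤ] → 𝐀` sending `(i, j)` to `X ^ i * P ^ j`. -/
def ofFinsupp (q : ℂ) : (ℤ × ℤ →₀ ℂ) →ₗ[ℂ] QWeyl q :=
  Finsupp.linearCombination ℂ fun n => (monomial q n : QWeyl q)

lemma X_mul_val_monomial (n : ℤ × ℤ) :
    X (u : ℂ) * monomial (u : ℂ) n = monomial (u : ℂ) (n.1 + 1, n.2) :=
  congrArg Units.val (unitX_mul_monomial (u : ℂ) n)

lemma P_mul_val_monomial (n : ℤ × ℤ) :
    P (u : ℂ) * monomial (u : ℂ) n =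
      ((u : ℂ) ^ (-n.1)) • (monomial (u : ℂ) (n.1, n.2 + 1) : QWeyl (u : ℂ)) := by
  have := congrArg Units.val (unitP_mul_monomial u n)
  rw [val_scalarUnit_mul] at this
  rwa [Units.val_zpow_eq_zpow_val] at this

lemma Xinv_mul_val_monomial (n : ℤ × ℤ) :
    Xinv (u : ℂ) * monomial (u : ℂ) n = monomial (u : ℂ) (n.1 - 1, n.2) := by
  have := X_mul_val_monomial u (n.1 - 1, n.2)
  rw [sub_add_cancel] at this
  rw [← this, ← mul_assoc, Xinv_mul_X, one_mul]

lemma Pinv_mul_val_monomial (n : ℤ × ℤ) :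
    Pinv (u : ℂ) * monomial (u : ℂ) n =
      ((u : ℂ) ^ n.1) • (monomial (u : ℂ) (n.1, n.2 - 1) : QWeyl (u : ℂ)) := by
  have := P_mul_val_monomial u (n.1, n.2 - 1)
  rw [sub_add_cancel] at this
  have h := congrArg (((u : ℂ) ^ n.1) • Pinv (u : ℂ) * ·) this
  simp only [smul_mul_assoc, ← mul_assoc, Pinv_mul_P, one_mul, mul_smul_comm, smul_smul] at h
  rw [← zpow_add₀ u.ne_zero, neg_add_cancel, zpow_zero, one_smul] at h
  exact h.symm

lemma ofFinsupp_repGen (i : Fin 4) (v : ℤ × ℤ →₀ ℂ) :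
    ofFinsupp (u : ℂ) (repGen u i v) =
      RingQuot.mkAlgHom ℂ (qWeylRel u) (FreeAlgebra.ι ℂ i) * ofFinsupp u v := by
  suffices h : ofFinsupp (u : ℂ) ∘ₗ repGen u i = LinearMap.mulLeft ℂ
      (RingQuot.mkAlgHom ℂ (qWeylRel u) (FreeAlgebra.ι ℂ i)) ∘ₗ ofFinsupp u from
    LinearMap.congr_fun h v
  refine Finsupp.lhom_ext' fun n => LinearMap.ext_ring ?_
  fin_cases i
  · have := X_mul_val_monomial u n
    rw [X] at this
    simp [ofFinsupp, repGen, this]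
  · have := Xinv_mul_val_monomial u n
    rw [Xinv] at this
    simp [ofFinsupp, repGen, this]
  · have := P_mul_val_monomial u n
    rw [P] at this
    simp [ofFinsupp, repGen, this]
  · have := Pinv_mul_val_monomial u n
    rw [Pinv] at this
    simp [ofFinsupp, repGen, this]

lemma ofFinsupp_rep (a : QWeyl (u : ℂ)) (v : ℤ × ℤ →₀ ℂ) :
    ofFinsupp (u : ℂ) (rep u a v) = a * ofFinsupp u v := by
  obtain ⟨a, rfl⟩ := RingQuot.mkAlgHom_surjective ℂ (qWeylRel (u : ℂ)) a
  induction a using FreeAlgebra.induction generalizing v with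
  | grade0 c => simp [Algebra.smul_def]
  | grade1 i => rw [rep_mkAlgHom_ι, ofFinsupp_repGen]
  | mul a b ha hb => rw [map_mul, map_mul, Module.End.mul_apply, ha, hb, mul_assoc]
  | add a b ha hb => rw [map_add, map_add, LinearMap.add_apply, map_add, ha, hb, add_mul]

lemma rep_monomial (n : ℤ × ℤ) :
    rep u (monomial (u : ℂ) n : QWeyl (u : ℂ)) (Finsupp.single 0 1) = Finsupp.single n 1 := by
  have hX (n : ℤ × ℤ) : rep u (monomial (u : ℂ) (n.1 + 1, n.2) : QWeyl (u : ℂ))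
      (Finsupp.single 0 1) = repGen u 0 (rep u (monomial (u : ℂ) n : QWeyl (u : ℂ))
        (Finsupp.single 0 1)) := by
    rw [← X_mul_val_monomial, map_mul, X, rep_mkAlgHom_ι, Module.End.mul_apply]
  have hX' (n : ℤ × ℤ) : rep u (monomial (u : ℂ) (n.1 - 1, n.2) : QWeyl (u : ℂ))
      (Finsupp.single 0 1) = repGen u 1 (rep u (monomial (u : ℂ) n : QWeyl (u : ℂ))
        (Finsupp.single 0 1)) := by
    rw [← Xinv_mul_val_monomial, map_mul, Xinv, rep_mkAlgHom_ι, Module.End.mul_apply]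
  have hP (n : ℤ × ℤ) : rep u (monomial (u : ℂ) (n.1, n.2 + 1) : QWeyl (u : ℂ))
      (Finsupp.single 0 1) = (u : ℂ) ^ n.1 • repGen u 2 (rep u (monomial (u : ℂ) n :
        QWeyl (u : ℂ)) (Finsupp.single 0 1)) := by
    rw [← rep_mkAlgHom_ι, ← Module.End.mul_apply, ← map_mul, ← P, P_mul_val_monomial, map_smul,
      LinearMap.smul_apply, smul_smul, ← zpow_add₀ u.ne_zero, add_neg_cancel, zpow_zero, one_smul]
  have hP' (n : ℤ × ℤ) : rep u (monomial (u : ℂ) (n.1, n.2 - 1) : QWeyl (u : ℂ))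
      (Finsupp.single 0 1) = (u : ℂ) ^ (-n.1) • repGen u 3 (rep u (monomial (u : ℂ) n :
        QWeyl (u : ℂ)) (Finsupp.single 0 1)) := by
    rw [← rep_mkAlgHom_ι, ← Module.End.mul_apply, ← map_mul, ← Pinv, Pinv_mul_val_monomial,
      map_smul, LinearMap.smul_apply, smul_smul, ← zpow_add₀ u.ne_zero, neg_add_cancel, zpow_zero,
      one_smul]
  obtain ⟨i, j⟩ := n
  induction j using Int.induction_on with
  | zero =>
    induction i using Int.induction_on with
    | zero => simp [monomial, ← Prod.zero_eq_mk]
    | succ i ih => rw [hX (i, 0), ih]; simp [repGen]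
    | pred i ih => rw [hX' (-i, 0), ih]; simp [repGen]
  | succ j ih =>
    rw [hP (i, j), ih]
    simp [repGen, -Finsupp.single_mul, mul_inv_cancel₀ (zpow_ne_zero _ u.ne_zero)]
  | pred j ih =>
    rw [hP' (i, -j), ih]
    simp [repGen, -Finsupp.single_mul, inv_mul_cancel₀ (zpow_ne_zero _ u.ne_zero)]

/-- The basis `X ^ i * P ^ j` of the `q`-Weyl algebra. -/
def basis : Module.Basis (ℤ × ℤ) ℂ (QWeyl (u : ℂ)) := .ofRepr <|
  LinearEquiv.ofLinearMap ((LinearMap.applyₗ (Finsupp.single 0 1)) ∘ₗ (rep u).toLinearMap)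
    (ofFinsupp u) (Finsupp.lhom_ext' fun n => LinearMap.ext_ring <| by
      simp [ofFinsupp, rep_monomial])
    (LinearMap.ext fun a => by simp [ofFinsupp_rep]; simp [ofFinsupp, monomial])

lemma basis_apply (n : ℤ × ℤ) : basis u n = monomial (u : ℂ) n := by
  simp [basis, ofFinsupp]

end QWeyl

/-! ### Shifts of finitely supported functions on `ℤ` -/

namespace FinsuppShift

variable (R : Type*) {M : Type*} [Ring R] [AddCommGroup M] [Module R M]

/-- The difference `σ - 1`, where `σ` is the shift of finitely supported functions on `ℤ`. -/
def shiftSub (M : Type*) [AddCommGroup M] [Module R M] : Module.End R (ℤ →₀ M) :=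
  Finsupp.lmapDomain M R (· + 1) - 1

/-- The sum of the values of a finitely supported function on `ℤ`. -/
def total (M : Type*) [AddCommGroup M] [Module R M] : (ℤ →₀ M) →ₗ[R] M :=
  Finsupp.lsum ℕ fun _ => LinearMap.id

@[simp]
lemma shiftSub_single (i : ℤ) (m : M) :
    shiftSub R M (Finsupp.single i m) = Finsupp.single (i + 1) m - Finsupp.single i m := by
  simp [shiftSub]

@[simp]
lemma total_single (i : ℤ) (m : M) : total R M (Finsupp.single i m) = m := by
  simp [total]

@[simp]
lemma total_shiftSub (w : ℤ →₀ M) : total R M (shiftSub R M w) = 0 := by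
  suffices h : total R M ∘ₗ shiftSub R M = 0 from LinearMap.congr_fun h w
  ext i m
  simp

lemma shiftSub_injective : Function.Injective (shiftSub R M) := by
  refine (injective_iff_map_eq_zero _).2 fun w hw => ?_
  have hstep (i : ℤ) : w (i + 1) = w i := by
    have := DFunLike.congr_fun hw (i + 1)
    simp only [shiftSub, LinearMap.sub_apply, Finsupp.lmapDomain_apply, Module.End.one_apply,
      Finsupp.sub_apply, Finsupp.zero_apply,
      Finsupp.mapDomain_apply (add_left_injective (1 : ℤ))] at this
    exact (sub_eq_zero.1 this).symm
  have hconst (i : ℤ) : w i = w 0 := by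
    induction i using Int.induction_on with
    | zero => rfl
    | succ i ih => rw [hstep, ih]
    | pred i ih => rw [← ih, ← hstep (-i - 1), sub_add_cancel]
  obtain ⟨i, hi⟩ := Infinite.exists_notMem_finset w.support
  ext j
  rw [hconst j, ← hconst i, Finsupp.notMem_support_iff.1 hi, Finsupp.zero_apply]

lemma exists_shiftSub_eq_sub (w : ℤ →₀ M) :
    ∃ z, shiftSub R M z = w - Finsupp.single 0 (total R M w) := by
  induction w using Finsupp.induction_linear with
  | zero => exact ⟨0, by simp⟩
  | add f g hf hg =>
    obtain ⟨y, hy⟩ := hf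
    obtain ⟨z, hz⟩ := hg
    refine ⟨y + z, ?_⟩
    rw [map_add, hy, hz, map_add, Finsupp.single_add]
    abel
  | single i m =>
    induction i using Int.induction_on with
    | zero => exact ⟨0, by simp⟩
    | succ i ih =>
      obtain ⟨z, hz⟩ := ih
      refine ⟨z + Finsupp.single (i : ℤ) m, ?_⟩
      rw [map_add, hz]
      simp
    | pred i ih =>
      obtain ⟨z, hz⟩ := ih
      refine ⟨z - Finsupp.single (-(i : ℤ) - 1) m, ?_⟩
      rw [map_sub, hz]
      simp

lemma exists_shiftSub_eq {w : ℤ →₀ M} (hw : total R M w = 0) : ∃ z, shiftSub R M z = w := by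
  simpa [hw] using exists_shiftSub_eq_sub R w

/-- The difference `σ - 1` for the shift in the inner variable. -/
def innerShiftSub (M : Type*) [AddCommGroup M] [Module R M] : Module.End R (ℤ →₀ ℤ →₀ M) :=
  Finsupp.mapRange.linearMap (shiftSub R M)

@[simp]
lemma innerShiftSub_single (i : ℤ) (w : ℤ →₀ M) :
    innerShiftSub R M (Finsupp.single i w) = Finsupp.single i (shiftSub R M w) := by
  simp [innerShiftSub]

lemma total_innerShiftSub (w : ℤ →₀ ℤ →₀ M) :
    total R (ℤ →₀ M) (innerShiftSub R M w) = shiftSub R M (total R (ℤ →₀ M) w) := by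
  suffices h : total R (ℤ →₀ M) ∘ₗ innerShiftSub R M = shiftSub R M ∘ₗ total R (ℤ →₀ M) from
    LinearMap.congr_fun h w
  refine Finsupp.lhom_ext' fun i => LinearMap.ext fun m => ?_
  simp

lemma shiftSub_innerShiftSub (w : ℤ →₀ ℤ →₀ M) :
    shiftSub R (ℤ →₀ M) (innerShiftSub R M w) = innerShiftSub R M (shiftSub R (ℤ →₀ M) w) := by
  suffices h : shiftSub R (ℤ →₀ M) ∘ₗ innerShiftSub R M =
      innerShiftSub R M ∘ₗ shiftSub R (ℤ →₀ M) from LinearMap.congr_fun h w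
  refine Finsupp.lhom_ext' fun i => LinearMap.ext fun m => ?_
  simp

lemma exists_of_shiftSub_add_eq_zero {s t : ℤ →₀ ℤ →₀ M}
    (h : shiftSub R (ℤ →₀ M) s + innerShiftSub R M t = 0) :
    ∃ w, -innerShiftSub R M w = s ∧ shiftSub R (ℤ →₀ M) w = t := by
  have ht : total R (ℤ →₀ M) t = 0 := by
    apply shiftSub_injective R
    simpa [total_innerShiftSub] using congrArg (total R (ℤ →₀ M)) h
  obtain ⟨w, rfl⟩ := exists_shiftSub_eq R ht
  refine ⟨w, shiftSub_injective R ?_, rfl⟩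
  rw [map_neg, shiftSub_innerShiftSub]
  exact (eq_neg_of_add_eq_zero_left h).symm

lemma exists_shiftSub_add_eq {w : ℤ →₀ ℤ →₀ M} (hw : total R M (total R (ℤ →₀ M) w) = 0) :
    ∃ s t, shiftSub R (ℤ →₀ M) s + innerShiftSub R M t = w := by
  obtain ⟨z, hz⟩ := exists_shiftSub_eq R hw
  obtain ⟨y, hy⟩ := exists_shiftSub_eq_sub R w
  exact ⟨y, Finsupp.single 0 z, by rw [hy, innerShiftSub_single, hz, sub_add_cancel]⟩

end FinsuppShift

/-! ### Algebras with a basis of monomials in two `q`-commuting units -/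

/-- The group homomorphism sending a unit `a` to `a ⊗ a⁻¹`, which acts by conjugation. -/
def conj (S : Type) [Ring S] [Algebra ℂ S] : Sˣ →* env S where
  toFun a := (a : S) ⊗ₜ op ((a⁻¹ : Sˣ) : S)
  map_one' := by simp [Algebra.TensorProduct.one_def]
  map_mul' a b := by simp

/-- A basis of `S` consisting of monomials in two units `x` and `p` with `x * p = u • p * x`. -/
structure MonomialBasis (S : Type) [Ring S] [Algebra ℂ S] (u : ℂˣ) where
  /-- The first unit. -/
  x : Sˣ
  /-- The second unit. -/
  p : Sˣ
  /-- The monomial with given exponents. -/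
  monomial : ℤ × ℤ → Sˣ
  /-- The monomials form a basis. -/
  basis : Module.Basis (ℤ × ℤ) ℂ S
  basis_apply (n : ℤ × ℤ) : basis n = monomial n
  monomial_zero : monomial 0 = 1
  x_mul_monomial (n : ℤ × ℤ) : x * monomial n = monomial (n.1 + 1, n.2)
  monomial_mul_p (n : ℤ × ℤ) : monomial n * p = monomial (n.1, n.2 + 1)
  p_mul_monomial (n : ℤ × ℤ) :
    p * monomial n = scalarUnit (u ^ (-n.1)) * monomial (n.1, n.2 + 1)
  monomial_mul_x (n : ℤ × ℤ) :
    monomial n * x = scalarUnit (u ^ (-n.2)) * monomial (n.1 + 1, n.2)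
  monomial_inv (n : ℤ × ℤ) :
    (monomial n)⁻¹ = scalarUnit (u ^ (-(n.1 * n.2))) * monomial (-n)

namespace MonomialBasis

variable {S : Type} [Ring S] [Algebra ℂ S]

lemma conj_apply (a : Sˣ) : conj S a = (a : S) ⊗ₜ op ((a⁻¹ : Sˣ) : S) := rfl

lemma conj_scalarUnit (c : ℂˣ) : conj S (scalarUnit c) = 1 := by
  rw [conj_apply, ← map_inv]
  change algebraMap ℂ S (c : ℂ) ⊗ₜ algebraMap ℂ Sᵐᵒᵖ ((c⁻¹ : ℂˣ) : ℂ) = 1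
  rw [Algebra.algebraMap_eq_smul_one, Algebra.algebraMap_eq_smul_one, TensorProduct.smul_tmul_smul,
    Units.mul_inv, one_smul, Algebra.TensorProduct.one_def]

attribute [local instance] TensorProduct.Algebra.module

lemma conj_smul (a : Sˣ) (s : S) : conj S a • s = a * s * (a⁻¹ : Sˣ) :=
  (TensorProduct.Algebra.smul_def (a : S) (op ((a⁻¹ : Sˣ) : S)) s).trans (mul_assoc _ _ _).symm

lemma algebraMap_env_smul (c : ℂ) (s : S) : algebraMap ℂ (env S) c • s = c • s := by
  rw [Algebra.TensorProduct.algebraMap_apply, TensorProduct.Algebra.smul_def, one_smul,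
    Algebra.smul_def, smul_eq_mul]

variable {u : ℂˣ} (T : MonomialBasis S u)

/-- The basis of the opposite algebra consisting of the inverses of the monomials. -/
def opBasis : Module.Basis (ℤ × ℤ) ℂ Sᵐᵒᵖ :=
  ((T.basis.reindex (Equiv.neg _)).unitsSMul fun n => u ^ (-(n.1 * n.2))).map (opLinearEquiv ℂ)

lemma opBasis_apply (n : ℤ × ℤ) : T.opBasis n = op (((T.monomial n)⁻¹ : Sˣ) : S) := by
  rw [monomial_inv, val_scalarUnit_mul]
  simp [opBasis, Module.Basis.unitsSMul_apply, basis_apply, Units.smul_def]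

/-- The basis of the enveloping algebra as a left `S`-module consisting of the conjugations by
monomials. -/
def envBasis : Module.Basis (ℤ × ℤ) S (env S) :=
  (Algebra.TensorProduct.basis S T.opBasis).unitsSMul T.monomial

lemma envBasis_apply (n : ℤ × ℤ) : T.envBasis n = conj S (T.monomial n) := by
  rw [envBasis, Module.Basis.unitsSMul_apply, Algebra.TensorProduct.basis_apply, opBasis_apply,
    Units.smul_def, TensorProduct.smul_tmul', smul_eq_mul, mul_one, conj_apply]

/-- The enveloping algebra as a module of finitely supported functions. -/
def envEquiv : env S ≃ₗ[S] (ℤ →₀ ℤ →₀ S) :=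
  T.envBasis.repr ≪≫ₗ Finsupp.curryLinearEquiv S

lemma envEquiv_conj (n : ℤ × ℤ) :
    T.envEquiv (conj S (T.monomial n)) = Finsupp.single n.1 (Finsupp.single n.2 1) := by
  simp [envEquiv, ← envBasis_apply]

/-- The element of the enveloping algebra acting as `a ↦ x * a * x⁻¹ - a`. -/
def conjX : env S := conj S T.x - 1

/-- The element of the enveloping algebra acting as `a ↦ p * a * p⁻¹ - a`. -/
def conjP : env S := conj S T.p - 1

lemma conj_monomial_mul_conj_x (n : ℤ × ℤ) :
    conj S (T.monomial n) * conj S T.x = conj S (T.monomial (n.1 + 1, n.2)) := by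
  rw [← map_mul, monomial_mul_x, map_mul, conj_scalarUnit, one_mul]

lemma conj_monomial_mul_conj_p (n : ℤ × ℤ) :
    conj S (T.monomial n) * conj S T.p = conj S (T.monomial (n.1, n.2 + 1)) := by
  rw [← map_mul, monomial_mul_p]

lemma commute_conjX_conjP : Commute T.conjX T.conjP := by
  have h : Commute (conj S T.x) (conj S T.p) := by
    have hx : conj S T.x = conj S (T.monomial (1, 0)) := by
      simpa [monomial_zero] using T.conj_monomial_mul_conj_x 0
    have hp : conj S T.p = conj S (T.monomial (0, 1)) := by
      simpa [monomial_zero] using T.conj_monomial_mul_conj_p 0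
    calc conj S T.x * conj S T.p = conj S (T.monomial (1, 1)) := by
          rw [hx]; exact T.conj_monomial_mul_conj_p (1, 0)
      _ = conj S T.p * conj S T.x := by
          rw [hp]; exact (T.conj_monomial_mul_conj_x (0, 1)).symm
  exact (h.sub_right (Commute.one_right _)).sub_left (Commute.one_left _)

lemma envEquiv_mul_conjX (e : env S) :
    T.envEquiv (e * T.conjX) = FinsuppShift.shiftSub S (ℤ →₀ S) (T.envEquiv e) := by
  suffices h : T.envEquiv.toLinearMap ∘ₗ LinearMap.mulRight S T.conjX =
      FinsuppShift.shiftSub S (ℤ →₀ S) ∘ₗ T.envEquiv.toLinearMap from LinearMap.congr_fun h e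
  refine T.envBasis.ext fun n => ?_
  simp only [envBasis_apply, LinearMap.comp_apply, LinearMap.mulRight_apply, LinearEquiv.coe_coe,
    conjX, mul_sub, mul_one, conj_monomial_mul_conj_x, map_sub, envEquiv_conj,
    FinsuppShift.shiftSub_single]

lemma envEquiv_mul_conjP (e : env S) :
    T.envEquiv (e * T.conjP) = FinsuppShift.innerShiftSub S S (T.envEquiv e) := by
  suffices h : T.envEquiv.toLinearMap ∘ₗ LinearMap.mulRight S T.conjP =
      FinsuppShift.innerShiftSub S S ∘ₗ T.envEquiv.toLinearMap from LinearMap.congr_fun h e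
  refine T.envBasis.ext fun n => ?_
  simp only [envBasis_apply, LinearMap.comp_apply, LinearMap.mulRight_apply, LinearEquiv.coe_coe,
    conjP, mul_sub, mul_one, conj_monomial_mul_conj_p, map_sub, envEquiv_conj,
    FinsuppShift.innerShiftSub_single, FinsuppShift.shiftSub_single, Finsupp.single_sub]

lemma smul_one_eq_total (e : env S) :
    e • (1 : S) = FinsuppShift.total S S (FinsuppShift.total S (ℤ →₀ S) (T.envEquiv e)) := by
  let f : env S →ₗ[S] S :=
    { toFun e := e • (1 : S)
      map_add' a b := add_smul a b 1
      map_smul' a e := by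
        induction e using TensorProduct.induction_on with
        | zero =>
          have h : (0 : env S) • (1 : S) = 0 := Module.zero_smul _
          rw [smul_zero, h, smul_zero]
        | tmul b c =>
          rw [TensorProduct.smul_tmul', TensorProduct.Algebra.smul_def,
            TensorProduct.Algebra.smul_def, smul_assoc, RingHom.id_apply]
        | add b c hb hc => rw [smul_add, add_smul, hb, hc, add_smul, smul_add] }
  suffices h : f = FinsuppShift.total S S ∘ₗ FinsuppShift.total S (ℤ →₀ S) ∘ₗ
      T.envEquiv.toLinearMap from LinearMap.congr_fun h e
  refine T.envBasis.ext fun n => ?_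
  rw [envBasis_apply]
  change conj S (T.monomial n) • (1 : S) = _
  simp [conj_smul, envEquiv_conj]

lemma conjX_smul (s : S) : T.conjX • s = T.x * s * (T.x⁻¹ : Sˣ) - s := by
  rw [conjX, sub_smul, conj_smul, one_smul]

lemma conjP_smul (s : S) : T.conjP • s = T.p * s * (T.p⁻¹ : Sˣ) - s := by
  rw [conjP, sub_smul, conj_smul, one_smul]

/-- The Koszul resolution of `S` as a bimodule. -/
def resolution : ProjectiveResolution (envBimod S) :=
  Koszul.resolution T.commute_conjX_conjP (M := envBimod S) (m := (1 : S))
    ((T.conjX_smul 1).trans (by simp)) ((T.conjP_smul 1).trans (by simp))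
    (fun y => ⟨(y : S) ⊗ₜ 1, (TensorProduct.Algebra.smul_def (y : S) 1 (1 : S)).trans (by simp)⟩)
    (fun r hr => by
      obtain ⟨s, t, h⟩ := FinsuppShift.exists_shiftSub_add_eq S
        ((T.smul_one_eq_total r).symm.trans hr)
      exact ⟨T.envEquiv.symm s, T.envEquiv.symm t, T.envEquiv.injective <| by
        rw [map_add, envEquiv_mul_conjX, envEquiv_mul_conjP, LinearEquiv.apply_symm_apply,
          LinearEquiv.apply_symm_apply, h]⟩)
    (fun s t h => by
      have h' := congrArg T.envEquiv h
      rw [map_add, envEquiv_mul_conjX, envEquiv_mul_conjP, map_zero] at h'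
      obtain ⟨w, hs, ht⟩ := FinsuppShift.exists_of_shiftSub_add_eq_zero S h'
      refine ⟨T.envEquiv.symm w, T.envEquiv.injective ?_, T.envEquiv.injective ?_⟩
      · rw [map_neg, envEquiv_mul_conjP, LinearEquiv.apply_symm_apply, hs]
      · rw [envEquiv_mul_conjX, LinearEquiv.apply_symm_apply, ht])
    (fun w hw => by
      apply T.envEquiv.injective
      apply FinsuppShift.shiftSub_injective S
      rw [← envEquiv_mul_conjX, hw, map_zero, map_zero])

/-- The coefficient of the monomial with exponents `n`. -/
def coeff (n : ℤ × ℤ) : S →ₗ[ℂ] ℂ := T.basis.coord n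

lemma ext_coeff {s t : S} (h : ∀ n, T.coeff n s = T.coeff n t) : s = t :=
  T.basis.ext_elem h

/-- The eigenvalue of `conjX` on the monomial with exponents `n`. -/
def eigX (u : ℂˣ) (n : ℤ × ℤ) : ℂ := (u : ℂ) ^ n.2 - 1

/-- The eigenvalue of `conjP` on the monomial with exponents `n`. -/
def eigP (u : ℂˣ) (n : ℤ × ℤ) : ℂ := (u : ℂ) ^ (-n.1) - 1

lemma conjX_smul_monomial (n : ℤ × ℤ) :
    T.conjX • (T.monomial n : S) = eigX u n • (T.monomial n : S) := by
  have h : T.x * T.monomial n * T.x⁻¹ = scalarUnit (u ^ n.2) * T.monomial n := by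
    rw [mul_inv_eq_iff_eq_mul, mul_assoc, monomial_mul_x, x_mul_monomial, ← mul_assoc, ← map_mul,
      ← zpow_add, add_neg_cancel, zpow_zero, map_one, one_mul]
  rw [conjX_smul, ← Units.val_mul, ← Units.val_mul, h, val_scalarUnit_mul, eigX, sub_smul, one_smul,
    Units.val_zpow_eq_zpow_val]

lemma conjP_smul_monomial (n : ℤ × ℤ) :
    T.conjP • (T.monomial n : S) = eigP u n • (T.monomial n : S) := by
  have h : T.p * T.monomial n * T.p⁻¹ = scalarUnit (u ^ (-n.1)) * T.monomial n := by
    rw [mul_inv_eq_iff_eq_mul, mul_assoc, monomial_mul_p, p_mul_monomial]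
  rw [conjP_smul, ← Units.val_mul, ← Units.val_mul, h, val_scalarUnit_mul, eigP, sub_smul, one_smul,
    Units.val_zpow_eq_zpow_val]

lemma coeff_smul_of_diagonal (e : env S) (c : ℤ × ℤ → ℂ)
    (h : ∀ n, e • (T.monomial n : S) = c n • (T.monomial n : S)) (n : ℤ × ℤ) (s : S) :
    T.coeff n (e • s) = c n * T.coeff n s := by
  let f : S →ₗ[ℂ] S :=
    { toFun s := e • s
      map_add' := smul_add e
      map_smul' a s := by
        rw [← algebraMap_env_smul, ← algebraMap_env_smul, smul_smul, smul_smul,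
          Algebra.commutes, RingHom.id_apply] }
  suffices h : T.coeff n ∘ₗ f = c n • T.coeff n from LinearMap.congr_fun h s
  refine T.basis.ext fun m => ?_
  change T.coeff n (e • T.basis m) = c n * T.coeff n (T.basis m)
  rw [basis_apply, h, ← basis_apply, map_smul, coeff, Module.Basis.coord_apply,
    Module.Basis.repr_self, Finsupp.single_apply, smul_eq_mul]
  split_ifs with hmn
  · rw [hmn]
  · simp

lemma coeff_conjX_smul (n : ℤ × ℤ) (s : S) :
    T.coeff n (T.conjX • s) = eigX u n * T.coeff n s :=
  T.coeff_smul_of_diagonal _ (eigX u) T.conjX_smul_monomial n s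

lemma coeff_conjP_smul (n : ℤ × ℤ) (s : S) :
    T.coeff n (T.conjP • s) = eigP u n * T.coeff n s :=
  T.coeff_smul_of_diagonal _ (eigP u) T.conjP_smul_monomial n s

/-- The diagonal operator multiplying the coefficients by `c`. -/
def diagonal (c : ℤ × ℤ → ℂ) : S →ₗ[ℂ] S :=
  T.basis.constr ℂ fun n => c n • T.basis n

lemma coeff_diagonal (c : ℤ × ℤ → ℂ) (n : ℤ × ℤ) (s : S) :
    T.coeff n (T.diagonal c s) = c n * T.coeff n s := by
  suffices h : T.coeff n ∘ₗ T.diagonal c = c n • T.coeff n from LinearMap.congr_fun h s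
  refine T.basis.ext fun m => ?_
  simp only [diagonal, LinearMap.comp_apply, Module.Basis.constr_basis, map_smul, coeff,
    Module.Basis.coord_apply, Module.Basis.repr_self, Finsupp.single_apply, LinearMap.smul_apply,
    smul_eq_mul]
  split_ifs with hmn
  · rw [hmn]
  · simp

lemma coeff_smul_one (c : ℂ) (n : ℤ × ℤ) : T.coeff n (c • (1 : S)) = if 0 = n then c else 0 := by
  have h : (1 : S) = T.basis 0 := by rw [basis_apply, monomial_zero, Units.val_one]
  simp [h, coeff, Finsupp.single_apply]

lemma conjX_smul_smul_one (c : ℂ) : T.conjX • c • (1 : S) = 0 := by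
  refine T.ext_coeff fun n => ?_
  rw [coeff_conjX_smul, coeff_smul_one, map_zero]
  split_ifs with h
  · simp [← h, eigX]
  · exact mul_zero _

lemma conjP_smul_smul_one (c : ℂ) : T.conjP • c • (1 : S) = 0 := by
  refine T.ext_coeff fun n => ?_
  rw [coeff_conjP_smul, coeff_smul_one, map_zero]
  split_ifs with h
  · simp [← h, eigP]
  · exact mul_zero _

lemma coeff_zero_smul_one (c : ℂ) : T.coeff 0 (c • (1 : S)) = c := by
  rw [coeff_smul_one, if_pos rfl]

lemma coeff_zero_conjX_smul (s : S) : T.coeff 0 (T.conjX • s) = 0 := by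
  simp [coeff_conjX_smul, eigX]

lemma coeff_zero_conjP_smul (s : S) : T.coeff 0 (T.conjP • s) = 0 := by
  simp [coeff_conjP_smul, eigP]

lemma eig_cases (hu : ∀ n : ℤ, n ≠ 0 → (u : ℂ) ^ n ≠ 1) (n : ℤ × ℤ) :
    n = 0 ∨ eigX u n ≠ 0 ∨ eigX u n = 0 ∧ eigP u n ≠ 0 := by
  obtain ⟨i, j⟩ := n
  by_cases hj : j = 0
  · subst hj
    by_cases hi : i = 0
    · exact .inl (by rw [hi]; rfl)
    · exact .inr (.inr ⟨by simp [eigX], sub_ne_zero.2 (hu _ (neg_ne_zero.2 hi))⟩)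
  · exact .inr (.inl (sub_ne_zero.2 (hu j hj)))

/-- The operator inverting `conjX` on the monomials where it does not vanish. -/
def invX : S →ₗ[ℂ] S := T.diagonal fun n => (eigX u n)⁻¹

/-- The operator inverting `conjP` on the monomials where `conjX` vanishes but `conjP` does
not. -/
def invP : S →ₗ[ℂ] S := T.diagonal fun n => if eigX u n = 0 then (eigP u n)⁻¹ else 0

variable (hu : ∀ n : ℤ, n ≠ 0 → (u : ℂ) ^ n ≠ 1)
include T hu

lemma eq_zero_of_conj_smul {s : S} (hx : T.conjX • s = 0) (hp : T.conjP • s = 0)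
    (hs : T.coeff 0 s = 0) : s = 0 := by
  refine T.ext_coeff fun n => ?_
  have hxn := congrArg (T.coeff n) hx
  have hpn := congrArg (T.coeff n) hp
  rw [coeff_conjX_smul, map_zero] at hxn
  rw [coeff_conjP_smul, map_zero] at hpn
  rw [map_zero]
  rcases eig_cases hu n with rfl | h | ⟨-, h⟩
  · exact hs
  · exact (mul_eq_zero.1 hxn).resolve_left h
  · exact (mul_eq_zero.1 hpn).resolve_left h

lemma exists_conj_smul_eq {s t : S} (h : T.conjP • s = T.conjX • t) (hs : T.coeff 0 s = 0)
    (ht : T.coeff 0 t = 0) : ∃ r : S, T.conjX • r = s ∧ T.conjP • r = t := by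
  have hn (n : ℤ × ℤ) : eigP u n * T.coeff n s = eigX u n * T.coeff n t := by
    rw [← coeff_conjP_smul, h, coeff_conjX_smul]
  refine ⟨T.invX s + T.invP t, T.ext_coeff fun n => ?_, T.ext_coeff fun n => ?_⟩
  · rw [coeff_conjX_smul, map_add, invX, invP, coeff_diagonal, coeff_diagonal]
    rcases eig_cases hu n with rfl | h | ⟨h, h'⟩
    · simp [hs, ht]
    · simp [h]
    · have := hn n
      rw [h, zero_mul] at this
      simp [h, (mul_eq_zero.1 this).resolve_left h']
  · rw [coeff_conjP_smul, map_add, invX, invP, coeff_diagonal, coeff_diagonal]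
    rcases eig_cases hu n with rfl | h | ⟨h, h'⟩
    · simp [hs, ht]
    · rw [if_neg h, zero_mul, add_zero, mul_left_comm, hn, inv_mul_cancel_left₀ h]
    · simp [h, h']

lemma exists_conj_smul_sub_eq {s : S} (hs : T.coeff 0 s = 0) :
    ∃ a b : S, T.conjX • b - T.conjP • a = s := by
  refine ⟨-T.invP s, T.invX s, T.ext_coeff fun n => ?_⟩
  rw [map_sub, coeff_conjX_smul, coeff_conjP_smul, map_neg, invX, invP, coeff_diagonal,
    coeff_diagonal]
  rcases eig_cases hu n with rfl | h | ⟨h, h'⟩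
  · simp [hs]
  · simp [h]
  · simp [h, h']

lemma nonempty_HHcoh_zero_iso : Nonempty (HHcoh S 0 ≅ ModuleCat.of ℂ ℂ) := by
  obtain ⟨e⟩ := Koszul.nonempty_homology_zero_iso (k := ℂ) T.commute_conjX_conjP (envBimod S)
    (W := ℂ) (T.coeff 0).toAddMonoidHom
    (fun c (x : S) => by
      change T.coeff 0 (algebraMap ℂ (env S) c • x) = _
      rw [algebraMap_env_smul, map_smul]; rfl)
    (fun c => ⟨(c • (1 : S) : S), T.conjX_smul_smul_one c, T.conjP_smul_smul_one c,
      T.coeff_zero_smul_one c⟩)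
    (fun (x : S) hx hp h => T.eq_zero_of_conj_smul hu hx hp h)
  exact ⟨T.resolution.isoExt (R := ℂ) 0 (envBimod S) ≪≫ e⟩

lemma nonempty_HHcoh_one_iso : Nonempty (HHcoh S 1 ≅ ModuleCat.of ℂ (Fin 2 → ℂ)) := by
  let φ : S × S →ₗ[ℂ] Fin 2 → ℂ :=
    LinearMap.pi ![T.coeff 0 ∘ₗ LinearMap.fst ℂ S S, T.coeff 0 ∘ₗ LinearMap.snd ℂ S S]
  have hφ (x : S × S) : φ x = 0 ↔ T.coeff 0 x.1 = 0 ∧ T.coeff 0 x.2 = 0 := by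
    simp [φ, funext_iff, Fin.forall_fin_two]
  obtain ⟨e⟩ := Koszul.nonempty_homology_one_iso (k := ℂ) T.commute_conjX_conjP (envBimod S)
    (W := Fin 2 → ℂ) φ.toAddMonoidHom
    (fun c (x : S × S) => by
      refine Eq.trans (congrArg φ (Prod.ext (algebraMap_env_smul c x.1)
        (algebraMap_env_smul c x.2))) (map_smul φ c x))
    (fun w => ⟨((w 0 • (1 : S), w 1 • (1 : S)) : S × S),
      (T.conjP_smul_smul_one _).trans (T.conjX_smul_smul_one _).symm, funext fun i => by
        fin_cases i <;> exact T.coeff_zero_smul_one _⟩)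
    (fun (x : S × S) hx => (hφ x).trans
      ⟨fun h => (T.exists_conj_smul_eq hu hx h.1 h.2).imp fun y hy => Prod.ext hy.1 hy.2, by
        rintro ⟨y, rfl⟩
        exact ⟨T.coeff_zero_conjX_smul y, T.coeff_zero_conjP_smul y⟩⟩)
  exact ⟨T.resolution.isoExt (R := ℂ) 1 (envBimod S) ≪≫ e⟩

lemma nonempty_HHcoh_two_iso : Nonempty (HHcoh S 2 ≅ ModuleCat.of ℂ ℂ) := by
  obtain ⟨e⟩ := Koszul.nonempty_homology_two_iso (k := ℂ) T.commute_conjX_conjP (envBimod S)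
    (W := ℂ) (T.coeff 0).toAddMonoidHom
    (fun c (x : S) => by
      change T.coeff 0 (algebraMap ℂ (env S) c • x) = _
      rw [algebraMap_env_smul, map_smul]; rfl)
    (fun c => ⟨(c • (1 : S) : S), T.coeff_zero_smul_one c⟩)
    (fun (x : S) => ⟨fun h => by
      obtain ⟨a, b, hab⟩ := T.exists_conj_smul_sub_eq hu h
      exact ⟨((a, b) : S × S), hab⟩, by
      rintro ⟨y, rfl⟩
      change T.coeff 0 (T.conjX • (y.2 : S) - T.conjP • (y.1 : S)) = 0
      rw [map_sub, coeff_zero_conjX_smul, coeff_zero_conjP_smul, sub_zero]⟩)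
  exact ⟨T.resolution.isoExt (R := ℂ) 2 (envBimod S) ≪≫ e⟩

omit hu in
lemma isZero_HHcoh (n : ℕ) : Limits.IsZero (HHcoh S (n + 3)) :=
  (Koszul.isZero_homology (k := ℂ) T.commute_conjX_conjP (envBimod S) n).of_iso
    (T.resolution.isoExt (R := ℂ) (n + 3) (envBimod S))

end MonomialBasis

/-- The basis of monomials `X ^ i * P ^ j` of the `q`-Weyl algebra. -/
def QWeyl.monomialBasis (u : ℂˣ) : MonomialBasis (QWeyl (u : ℂ)) u where
  x := unitX u
  p := unitP u
  monomial := monomial u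
  basis := QWeyl.basis u
  basis_apply := QWeyl.basis_apply u
  monomial_zero := by simp [monomial]
  x_mul_monomial := unitX_mul_monomial u
  monomial_mul_p := monomial_mul_unitP u
  p_mul_monomial := unitP_mul_monomial u
  monomial_mul_x := monomial_mul_unitX u
  monomial_inv := QWeyl.monomial_inv u

/-- Let `q ∈ ℂˣ` be not a root of unity.  Then the Hochschild
cohomology of the `q`-Weyl algebra `𝐀` satisfies `HH^0(𝐀) ≅ ℂ`, `HH^1(𝐀) ≅ ℂ²`,
`HH^2(𝐀) ≅ ℂ`, and `HH^i(𝐀) = 0` for `i ≠ 0, 1, 2`. -/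
theorem statement15 (q : ℂ) (hq0 : q ≠ 0) (hq : ∀ n : ℕ, 0 < n → q ^ n ≠ 1) :
    Nonempty (HHcoh (QWeyl q) 0 ≅ ModuleCat.of ℂ ℂ) ∧
    Nonempty (HHcoh (QWeyl q) 1 ≅ ModuleCat.of ℂ (Fin 2 → ℂ)) ∧
    Nonempty (HHcoh (QWeyl q) 2 ≅ ModuleCat.of ℂ ℂ) ∧
    ∀ i : ℕ, i ≠ 0 → i ≠ 1 → i ≠ 2 → Limits.IsZero (HHcoh (QWeyl q) i) := by
  have hu (n : ℤ) (hn : n ≠ 0) : ((Units.mk0 q hq0 : ℂˣ) : ℂ) ^ n ≠ 1 := by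
    rw [Units.val_mk0]
    obtain ⟨m, rfl | rfl⟩ := n.eq_nat_or_neg
    · rw [zpow_natCast]
      exact hq m (by omega)
    · rw [zpow_neg, zpow_natCast, inv_ne_one]
      exact hq m (by omega)
  let T := QWeyl.monomialBasis (Units.mk0 q hq0)
  refine ⟨T.nonempty_HHcoh_zero_iso hu, T.nonempty_HHcoh_one_iso hu, T.nonempty_HHcoh_two_iso hu,
    fun i h₀ h₁ h₂ => ?_⟩
  obtain ⟨n, rfl⟩ : ∃ n, i = n + 3 := ⟨i - 3, by omega⟩
  exact T.isZero_HHcoh n
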